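/- arXiv:math-ph/0308005 — 2 statements merged into one kernel-verified Lean document; each statement's English description precedes it below -/
import Mathlib

section
/- Let v ≥ 2 and let the bond lengths L_1,…,L_v > 0 of a Neumann star graph be linearly independent over ℚ. Given any two distinct bond indices i₁ ≠ i₂, there exists a subsequence (k_{n_r}) of the eigenvalue sequence (k_n) such that for every vector observable f = (f_i)_{i=1}^v with each f_i : [0,L_i] → ℝ continuously differentiable, lim_{r→∞} ⟨ψ^{(n_r)}|f|ψ^{(n_r)}⟩ = (1/(L_{i₁}+L_{i₂})) · (∫_0^{L_{i₁}} f_{i₁}(x) dx + ∫_0^{L_{i₂}} f_{i₂}(x) dx). -/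
open scoped Real Topology
open Filter

/-- `sec² x = (cos x)⁻²`. -/
noncomputable def sec2 (x : ℝ) : ℝ := (Real.cos x)⁻¹ ^ 2

/-- `k : ℕ → ℝ` enumerates, in increasing order, all the eigenvalues of the Neumann
star graph with bond lengths `L`, i.e. all positive solutions `k` (with
`cos (k L_j) ≠ 0` for all `j`) of `∑_j tan (k L_j) = 0`. -/
def IsEigenvalueSeq (b : ℕ) (L : Fin b → ℝ) (k : ℕ → ℝ) : Prop :=
  StrictMono k ∧ (∀ n, 0 < k n) ∧
  (∀ n j, Real.cos (k n * L j) ≠ 0) ∧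
  (∀ n, ∑ j, Real.tan (k n * L j) = 0) ∧
  (∀ x : ℝ, 0 < x → (∀ j, Real.cos (x * L j) ≠ 0) →
    ∑ j, Real.tan (x * L j) = 0 → ∃ n, k n = x)

section Kronecker

open MeasureTheory UnitAddTorus

variable {ι : Type*}

/-- The linear flow `t ↦ t • L` on the torus `(ℝ / ℤ)^ι`. -/
def torusFlow (L : ι → ℝ) (t : ℝ) : UnitAddTorus ι := fun j => ((t * L j : ℝ) : UnitAddCircle)

theorem continuous_torusFlow (L : ι → ℝ) : Continuous (torusFlow L) :=
  continuous_pi fun _ => (AddCircle.continuous_mk' 1).comp (by fun_prop)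

/-- The time average of `f` along the linear flow with frequencies `L`. -/
noncomputable def flowMean (L : ι → ℝ) (f : C(UnitAddTorus ι, ℂ)) (X : ℝ) : ℂ :=
  (X : ℂ)⁻¹ * ∫ t in (0 : ℝ)..X, f (torusFlow L t)

theorem intervalIntegrable_torusFlow (L : ι → ℝ) (f : C(UnitAddTorus ι, ℂ)) (a b : ℝ) :
    IntervalIntegrable (fun t => f (torusFlow L t)) volume a b :=
  (f.continuous.comp (continuous_torusFlow L)).intervalIntegrable a b

theorem norm_flowMean_le (L : ι → ℝ) (f : C(UnitAddTorus ι, ℂ)) {X : ℝ} (hX : 0 < X) :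
    ‖flowMean L f X‖ ≤ ‖f‖ := by
  have h := intervalIntegral.norm_integral_le_of_norm_le_const (a := 0) (b := X)
    (f := fun t => f (torusFlow L t)) (C := ‖f‖) fun t _ => f.norm_coe_le_norm _
  rw [flowMean, norm_mul, norm_inv, Complex.norm_real, Real.norm_of_nonneg hX.le,
    inv_mul_le_iff₀ hX]
  rwa [sub_zero, abs_of_pos hX, mul_comm] at h

theorem flowMean_add (L : ι → ℝ) (f g : C(UnitAddTorus ι, ℂ)) (X : ℝ) :
    flowMean L (f + g) X = flowMean L f X + flowMean L g X := by
  simp only [flowMean, ContinuousMap.add_apply]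
  rw [intervalIntegral.integral_add (intervalIntegrable_torusFlow L f _ _)
    (intervalIntegrable_torusFlow L g _ _), mul_add]

theorem flowMean_smul (L : ι → ℝ) (c : ℂ) (f : C(UnitAddTorus ι, ℂ)) (X : ℝ) :
    flowMean L (c • f) X = c * flowMean L f X := by
  simp only [flowMean, ContinuousMap.smul_apply, smul_eq_mul,
    intervalIntegral.integral_const_mul]
  ring

variable [Fintype ι]

theorem volume_real_univ_unitAddTorus :
    (volume : Measure (UnitAddTorus ι)).real Set.univ = 1 := by
  simp [Measure.real, volume_pi, Measure.pi_univ]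

theorem mFourier_torusFlow (L : ι → ℝ) (n : ι → ℤ) (t : ℝ) :
    mFourier n (torusFlow L t) =
      Complex.exp (((2 * π * ∑ j, n j * L j : ℝ) : ℂ) * Complex.I * t) := by
  simp only [mFourier, torusFlow, ContinuousMap.coe_mk, fourier_coe_apply]
  rw [← Complex.exp_sum]
  congr 1
  push_cast
  simp only [Finset.mul_sum, Finset.sum_mul]
  refine Finset.sum_congr rfl fun j _ => ?_
  ring

theorem mFourier_apply_add (n : ι → ℤ) (x y : UnitAddTorus ι) :
    mFourier n (x + y) = mFourier n x * mFourier n y := by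
  simp [mFourier, fourier_apply, AddCircle.toCircle_add, Finset.prod_mul_distrib]

theorem sum_intCast_mul_ne_zero {L : ι → ℝ} (hL : LinearIndependent ℚ L) {n : ι → ℤ}
    (hn : n ≠ 0) : ∑ j, n j * L j ≠ 0 := by
  intro h
  refine hn (funext fun j => ?_)
  have := Fintype.linearIndependent_iff.1 hL (fun j => (n j : ℚ))
    (by simpa [Rat.smul_def] using h) j
  exact_mod_cast this

theorem integral_mFourier_eq_zero {L : ι → ℝ} (hL : LinearIndependent ℚ L) {n : ι → ℤ}
    (hn : n ≠ 0) : ∫ x : UnitAddTorus ι, mFourier n x = 0 := by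
  set a : ℝ := 2 * π * ∑ j, n j * L j with ha
  have ha0 : a ≠ 0 := mul_ne_zero (by positivity) (sum_intCast_mul_ne_zero hL hn)
  have hflow : mFourier n (torusFlow L (π / a)) = -1 := by
    rw [mFourier_torusFlow, ← ha, ← Complex.exp_pi_mul_I]
    congr 1
    have : (a : ℂ) ≠ 0 := by exact_mod_cast ha0
    push_cast
    field_simp
  have h := integral_add_right_eq_self (μ := (volume : Measure (UnitAddTorus ι)))
    (fun x => mFourier n x) (torusFlow L (π / a))
  simp only [mFourier_apply_add, hflow, mul_neg, mul_one, integral_neg] at h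
  exact self_eq_neg.1 h.symm

theorem tendsto_flowMean_mFourier {L : ι → ℝ} (hL : LinearIndependent ℚ L) (n : ι → ℤ) :
    Tendsto (flowMean L (mFourier n)) atTop (𝓝 (∫ x : UnitAddTorus ι, mFourier n x)) := by
  rcases eq_or_ne n 0 with rfl | hn
  · refine tendsto_const_nhds.congr' ?_
    filter_upwards [eventually_gt_atTop 0] with X hX
    have : (X : ℂ) ≠ 0 := by exact_mod_cast hX.ne'
    simp [flowMean, mFourier_zero, this, volume_real_univ_unitAddTorus]
  · rw [integral_mFourier_eq_zero hL hn]
    set a : ℝ := 2 * π * ∑ j, n j * L j with ha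
    have ha0 : a ≠ 0 := mul_ne_zero (by positivity) (sum_intCast_mul_ne_zero hL hn)
    have hc : (a : ℂ) * Complex.I ≠ 0 := by simpa using ha0
    refine squeeze_zero_norm' (a := fun X : ℝ => X⁻¹ * (2 / |a|)) ?_ ?_
    · filter_upwards [eventually_gt_atTop 0] with X hX
      simp only [flowMean, mFourier_torusFlow, ← ha]
      rw [integral_exp_mul_complex hc, norm_mul, norm_div]
      have h1 : ‖(X : ℂ)⁻¹‖ = X⁻¹ := by simp [abs_of_pos hX]
      have h2 : ‖(a : ℂ) * Complex.I‖ = |a| := by simp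
      rw [h1, h2]
      gcongr
      refine (norm_sub_le _ _).trans ?_
      simp [Complex.norm_exp]
      norm_num
    · simpa using tendsto_inv_atTop_zero.mul_const (2 / |a|)

theorem integrable_torus (f : C(UnitAddTorus ι, ℂ)) :
    Integrable f (volume : Measure (UnitAddTorus ι)) :=
  f.continuous.integrable_of_hasCompactSupport (HasCompactSupport.of_compactSpace _)

/-- Weyl equidistribution of a linear flow with rationally independent frequencies. -/
theorem tendsto_flowMean {L : ι → ℝ} (hL : LinearIndependent ℚ L) (f : C(UnitAddTorus ι, ℂ)) :
    Tendsto (flowMean L f) atTop (𝓝 (∫ x : UnitAddTorus ι, f x)) := by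
  have hspan : ∀ g ∈ Submodule.span ℂ (Set.range (mFourier (d := ι))),
      Tendsto (flowMean L g) atTop (𝓝 (∫ x : UnitAddTorus ι, g x)) := by
    intro g hg
    induction hg using Submodule.span_induction with
    | mem g hg =>
      obtain ⟨n, rfl⟩ := hg
      exact tendsto_flowMean_mFourier hL n
    | zero =>
      have : flowMean L (0 : C(UnitAddTorus ι, ℂ)) = fun _ => 0 := by
        ext X
        simp [flowMean]
      simp [this]
    | add g h _ _ hg hh =>
      simp only [ContinuousMap.add_apply]
      rw [integral_add (integrable_torus g) (integrable_torus h)]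
      exact (hg.add hh).congr fun X => (flowMean_add L g h X).symm
    | smul c g _ hg =>
      simp only [ContinuousMap.smul_apply, smul_eq_mul]
      rw [integral_const_mul]
      exact (hg.const_mul c).congr fun X => (flowMean_smul L c g X).symm
  rw [Metric.tendsto_nhds]
  intro ε hε
  have hf : f ∈ (Submodule.span ℂ (Set.range (mFourier (d := ι)))).topologicalClosure := by
    rw [span_mFourier_closure_eq_top]
    trivial
  obtain ⟨g, hg, hfg⟩ := Metric.mem_closure_iff.1 hf (ε / 3) (by positivity)
  rw [dist_eq_norm] at hfg
  filter_upwards [Metric.tendsto_nhds.1 (hspan g hg) (ε / 3) (by positivity),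
    eventually_gt_atTop 0] with X hX hX0
  have hdecomp : flowMean L f X - ∫ x : UnitAddTorus ι, f x =
      flowMean L (f - g) X + (flowMean L g X - ∫ x : UnitAddTorus ι, g x)
        - ∫ x : UnitAddTorus ι, (f - g) x := by
    have h1 := flowMean_add L (f - g) g X
    rw [sub_add_cancel] at h1
    simp only [ContinuousMap.sub_apply]
    rw [integral_sub (integrable_torus f) (integrable_torus g), h1]
    ring
  have h1 := norm_flowMean_le L (f - g) hX0
  have h2 : ‖∫ x : UnitAddTorus ι, (f - g) x‖ ≤ ‖f - g‖ := by
    simpa [volume_real_univ_unitAddTorus] using norm_integral_le_of_norm_le_const (μ := (volume : Measure (UnitAddTorus ι)))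
      (Eventually.of_forall fun x => (f - g).norm_coe_le_norm x)
  rw [dist_eq_norm] at hX ⊢
  rw [hdecomp]
  calc _ ≤ ‖flowMean L (f - g) X + (flowMean L g X - ∫ x : UnitAddTorus ι, g x)‖
        + ‖∫ x : UnitAddTorus ι, (f - g) x‖ := norm_sub_le _ _
    _ ≤ ‖flowMean L (f - g) X‖ + ‖flowMean L g X - ∫ x : UnitAddTorus ι, g x‖
        + ‖∫ x : UnitAddTorus ι, (f - g) x‖ := by gcongr; exact norm_add_le _ _
    _ < ε := by linarith

/-- Kronecker's theorem on simultaneous inhomogeneous approximation, at arbitrarily large times. -/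
theorem exists_gt_abs_mul_sub_sub_intCast_lt {L : ι → ℝ} (hL : LinearIndependent ℚ L)
    (θ : ι → ℝ) {ε : ℝ} (hε : 0 < ε) (T : ℝ) :
    ∃ t > T, ∃ m : ι → ℤ, ∀ j, |t * L j - θ j - m j| < ε := by
  by_contra! hcon
  set y : UnitAddTorus ι := fun j => (θ j : UnitAddCircle) with hy
  let b : C(UnitAddTorus ι, ℝ) := ⟨fun x => max 0 (ε - ‖x - y‖), by fun_prop⟩
  have hb : 0 < ∫ x, b x :=
    b.continuous.integral_pos_of_hasCompactSupport_nonneg_nonzero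
      (HasCompactSupport.of_compactSpace _) (fun x => le_max_left _ _)
      (x := y) (by simp [b, hε.ne', hε.le])
  let f : C(UnitAddTorus ι, ℂ) := ⟨fun x => (b x : ℂ), by fun_prop⟩
  have hf : ∀ t > T, f (torusFlow L t) = 0 := by
    intro t ht
    obtain ⟨j, hj⟩ := hcon t ht fun j => round (t * L j - θ j)
    have h1 : ‖(torusFlow L t - y) j‖ = |t * L j - θ j - round (t * L j - θ j)| := by
      rw [← UnitAddCircle.norm_eq]
      rfl
    have h2 := norm_le_pi_norm (torusFlow L t - y) j
    have h3 : b (torusFlow L t) = 0 := max_eq_left (by linarith)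
    simp [f, h3]
  have hlim : Tendsto (flowMean L f) atTop (𝓝 0) := by
    have h0 : Tendsto (fun X : ℝ => (X : ℂ)⁻¹ * ∫ t in (0 : ℝ)..T, f (torusFlow L t)) atTop
        (𝓝 0) := by
      simpa using (Complex.continuous_ofReal.tendsto 0 |>.comp
        tendsto_inv_atTop_zero).mul_const (∫ t in (0 : ℝ)..T, f (torusFlow L t))
    refine h0.congr' ?_
    filter_upwards [eventually_gt_atTop T] with X hX
    have hz : ∫ t in T..X, f (torusFlow L t) = 0 := by
      rw [intervalIntegral.integral_congr_ae (g := fun _ => 0)]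
      · simp
      · refine Eventually.of_forall fun t ht => hf t ?_
        rw [Set.uIoc_of_le hX.le] at ht
        exact ht.1
    rw [flowMean, ← intervalIntegral.integral_add_adjacent_intervals
      (intervalIntegrable_torusFlow L f 0 T) (intervalIntegrable_torusFlow L f T X), hz, add_zero]
  have heq := tendsto_nhds_unique hlim (tendsto_flowMean hL f)
  have : ∫ x, f x = ((∫ x, b x : ℝ) : ℂ) := integral_ofReal
  rw [this] at heq
  exact hb.ne (by exact_mod_cast heq)

end Kronecker

section TanRoots

theorem half_le_cos_of_abs_le_one {d : ℝ} (hd : |d| ≤ 1) : 1 / 2 ≤ Real.cos d := by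
  have h := Real.one_sub_sq_div_two_le_cos (x := d)
  have h2 : d ^ 2 ≤ 1 := (sq_le_one_iff_abs_le_one d).2 hd
  linarith

theorem sin_ne_zero_of_abs_le_one {d : ℝ} (hd : |d| ≤ 1) (h0 : d ≠ 0) : Real.sin d ≠ 0 := by
  have := Real.pi_gt_three
  obtain ⟨h1, h2⟩ := abs_le.1 hd
  rw [Ne, Real.sin_eq_zero_iff_of_lt_of_lt (by linarith) (by linarith)]
  exact h0

theorem abs_cos_add_int_mul_pi (d : ℝ) (m : ℤ) : |Real.cos (d + m * π)| = |Real.cos d| := by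
  rw [Real.cos_add_int_mul_pi, abs_mul, abs_neg_one_zpow, one_mul]

theorem abs_tan_add_int_mul_pi_le_two {d : ℝ} (hd : |d| ≤ 1) (m : ℤ) :
    Real.cos (d + m * π) ≠ 0 ∧ |Real.tan (d + m * π)| ≤ 2 := by
  have h : 1 / 2 ≤ |Real.cos (d + m * π)| := by
    rw [abs_cos_add_int_mul_pi]
    exact (half_le_cos_of_abs_le_one hd).trans (le_abs_self _)
  refine ⟨fun h0 => by norm_num [h0] at h, ?_⟩
  rw [Real.tan_eq_sin_div_cos, abs_div, div_le_iff₀ (by linarith)]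
  linarith [Real.abs_sin_le_one (d + m * π)]

theorem cos_add_pi_div_two_add_int_mul_pi (d : ℝ) (m : ℤ) :
    Real.cos (d + π / 2 + m * π) = -((-1) ^ m * Real.sin d) := by
  rw [Real.cos_add_int_mul_pi, Real.cos_add_pi_div_two, mul_neg]

theorem sin_add_pi_div_two_add_int_mul_pi (d : ℝ) (m : ℤ) :
    Real.sin (d + π / 2 + m * π) = (-1) ^ m * Real.cos d := by
  rw [Real.sin_add_int_mul_pi, Real.sin_add_pi_div_two]

theorem lt_abs_tan_near_pole {d η R : ℝ} (hd0 : d ≠ 0) (hd : |d| < η) (hη : η ≤ 1) (hR : 0 < R)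
    (hηR : 2 * η * R ≤ 1) (m : ℤ) : R < |Real.tan (d + π / 2 + m * π)| := by
  have hs := sin_ne_zero_of_abs_le_one (hd.le.trans hη) hd0
  have hc := half_le_cos_of_abs_le_one (hd.le.trans hη)
  rw [Real.tan_eq_sin_div_cos, abs_div, cos_add_pi_div_two_add_int_mul_pi,
    sin_add_pi_div_two_add_int_mul_pi, abs_neg, abs_mul, abs_mul, abs_neg_one_zpow, one_mul,
    one_mul, lt_div_iff₀ (abs_pos.2 hs)]
  have hsd : |Real.sin d| ≤ |d| := Real.abs_sin_le_abs
  have := le_abs_self (Real.cos d)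
  nlinarith

/-- The function `cos (x a) cos (x b) (tan (x a) + tan (x b) + S x)` changes sign between a pole of
`tan (x a)` and a close but distinct pole of `tan (x b)`. -/
theorem exists_tan_add_tan_add_eq_zero {a b p q : ℝ} (ha : 0 < a) (hb : 0 < b) (m n : ℤ)
    (hp : p * a = π / 2 + m * π) (hq : q * b = π / 2 + n * π) (hpq : p ≠ q)
    (hclose : ∀ x ∈ Set.uIcc p q, |(x - p) * a| ≤ 1 ∧ |(x - q) * b| ≤ 1)
    {S : ℝ → ℝ} (hS : ContinuousOn S (Set.uIcc p q)) :
    ∃ x ∈ Set.uIcc p q, x ≠ p ∧ x ≠ q ∧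
      Real.tan (x * a) + Real.tan (x * b) + S x = 0 := by
  have hxa : ∀ x, x * a = (x - p) * a + π / 2 + m * π := fun x => by rw [sub_mul, hp]; ring
  have hxb : ∀ x, x * b = (x - q) * b + π / 2 + n * π := fun x => by rw [sub_mul, hq]; ring
  set F : ℝ → ℝ := fun x => Real.sin (x * a) * Real.cos (x * b) +
    Real.cos (x * a) * Real.sin (x * b) + Real.cos (x * a) * Real.cos (x * b) * S x with hF
  have hFc : ContinuousOn F (Set.uIcc p q) := by
    refine ContinuousOn.add (Continuous.continuousOn (by fun_prop)) (ContinuousOn.mul ?_ hS)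
    exact Continuous.continuousOn (by fun_prop)
  have hsq : ∀ k : ℤ, (-1 : ℝ) ^ k * (-1) ^ k = 1 := fun k => by
    rw [← mul_zpow]; simp
  have hFp : F p = -((-1) ^ m * (-1) ^ n * Real.sin ((p - q) * b)) := by
    simp only [hF]
    rw [hxa p, hxb p, cos_add_pi_div_two_add_int_mul_pi, cos_add_pi_div_two_add_int_mul_pi,
      sin_add_pi_div_two_add_int_mul_pi]
    simp
    ring
  have hFq : F q = (-1) ^ m * (-1) ^ n * Real.sin ((p - q) * a) := by
    simp only [hF]
    rw [hxa q, hxb q, cos_add_pi_div_two_add_int_mul_pi, cos_add_pi_div_two_add_int_mul_pi,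
      sin_add_pi_div_two_add_int_mul_pi, sin_add_pi_div_two_add_int_mul_pi,
      ← neg_sub p q, neg_mul, Real.sin_neg]
    simp
    ring
  have hpb := (hclose p Set.left_mem_uIcc).2
  have hqa : |(p - q) * a| ≤ 1 := by
    rw [← abs_neg, ← neg_mul, neg_sub]
    exact (hclose q Set.right_mem_uIcc).1
  have hprod : F p * F q < 0 := by
    have : F p * F q = -(Real.sin ((p - q) * b) * Real.sin ((p - q) * a)) := by
      rw [hFp, hFq]
      linear_combination (-(Real.sin ((p - q) * b) * Real.sin ((p - q) * a))) *
        ((-1) ^ n * (-1) ^ n * hsq m + hsq n)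
    rw [this, neg_lt_zero]
    have hpi := Real.pi_gt_three
    rw [abs_le] at hpb hqa
    rcases lt_or_gt_of_ne (sub_ne_zero.2 hpq) with h | h
    · exact mul_pos_of_neg_of_neg
        (Real.sin_neg_of_neg_of_neg_pi_lt (mul_neg_of_neg_of_pos h hb) (by linarith))
        (Real.sin_neg_of_neg_of_neg_pi_lt (mul_neg_of_neg_of_pos h ha) (by linarith))
    · exact mul_pos (Real.sin_pos_of_pos_of_lt_pi (mul_pos h hb) (by linarith))
        (Real.sin_pos_of_pos_of_lt_pi (mul_pos h ha) (by linarith))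
  have h0 : (0 : ℝ) ∈ Set.uIcc (F p) (F q) := by
    rw [Set.mem_uIcc]
    rcases mul_neg_iff.1 hprod with h | h
    · exact Or.inr ⟨h.2.le, h.1.le⟩
    · exact Or.inl ⟨h.1.le, h.2.le⟩
  obtain ⟨x, hx, hx0⟩ := intermediate_value_uIcc hFc h0
  have hxp : x ≠ p := by
    rintro rfl
    simp [hx0] at hprod
  have hxq : x ≠ q := by
    rintro rfl
    simp [hx0] at hprod
  have hca : Real.cos (x * a) ≠ 0 := by
    rw [hxa, cos_add_pi_div_two_add_int_mul_pi, neg_ne_zero]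
    exact mul_ne_zero (zpow_ne_zero _ (by norm_num)) (sin_ne_zero_of_abs_le_one (hclose x hx).1
      (mul_ne_zero (sub_ne_zero.2 hxp) ha.ne'))
  have hcb : Real.cos (x * b) ≠ 0 := by
    rw [hxb, cos_add_pi_div_two_add_int_mul_pi, neg_ne_zero]
    exact mul_ne_zero (zpow_ne_zero _ (by norm_num)) (sin_ne_zero_of_abs_le_one (hclose x hx).2
      (mul_ne_zero (sub_ne_zero.2 hxq) hb.ne'))
  refine ⟨x, hx, hxp, hxq, ?_⟩
  simp only [hF] at hx0
  rw [Real.tan_eq_sin_div_cos, Real.tan_eq_sin_div_cos]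
  field_simp
  linear_combination hx0

theorem odd_mul_ne_odd_mul {ι : Type*} [Fintype ι] {L : ι → ℝ} (hind : LinearIndependent ℚ L)
    {i j : ι} (hij : i ≠ j) (m n : ℤ) : (1 + 2 * m : ℝ) * L j ≠ (1 + 2 * n) * L i := by
  classical
  intro h
  refine sum_intCast_mul_ne_zero hind
    (n := Pi.single j (1 + 2 * m) - Pi.single i (1 + 2 * n)) (fun h0 => ?_) ?_
  · have := congrFun h0 j
    simp [hij.symm] at this
    omega
  · simp [sub_mul, Finset.sum_sub_distrib, Pi.single_apply, h]

/-- Solutions of `∑ tan (x L_j) = 0` located between two close poles of `tan (x L_{i₁})` and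
`tan (x L_{i₂})`, and close to zeros of the other summands. -/
theorem exists_sum_tan_eq_zero {ι : Type*} [Fintype ι] {L : ι → ℝ} (hL : ∀ i, 0 < L i)
    (hind : LinearIndependent ℚ L) {i₁ i₂ : ι} (hne : i₁ ≠ i₂) {R : ℝ} (hR : 0 < R) :
    ∃ x > R, (∀ j, Real.cos (x * L j) ≠ 0) ∧ ∑ j, Real.tan (x * L j) = 0 ∧
      R < |Real.tan (x * L i₁)| ∧ ∀ j, j ≠ i₁ → j ≠ i₂ → |Real.tan (x * L j)| ≤ 2 := by
  classical
  set C : ℝ := (L i₁)⁻¹ + (L i₂)⁻¹ with hC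
  have h1 := inv_pos.2 (hL i₁)
  have h2 := inv_pos.2 (hL i₂)
  have hC0 : 0 < C := by positivity
  set D : ℝ := 1 + C * ∑ j, L j with hD
  have hLsum : ∀ j, L j ≤ ∑ j, L j := fun j =>
    Finset.single_le_sum (fun i _ => (hL i).le) (Finset.mem_univ j)
  have hD0 : 0 < D := by
    have := (hL i₁).trans_le (hLsum i₁)
    positivity
  set η : ℝ := min 1 (1 / (2 * R)) with hη
  have hη0 : 0 < η := lt_min one_pos (by positivity)
  have hη1 : η ≤ 1 := min_le_left _ _
  have hηR : 2 * η * R ≤ 1 := by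
    have := min_le_right 1 (1 / (2 * R))
    rw [← hη, le_div_iff₀ (by positivity)] at this
    linarith
  set ε : ℝ := η / D with hε
  have hε0 : 0 < ε := by positivity
  have hεD : ε + ε * C * ∑ j, L j = η := by
    have : ε * D = η := div_mul_cancel₀ _ hD0.ne'
    rw [hD] at this
    linarith
  let c : ι → ℝ := fun j => if j = i₁ ∨ j = i₂ then π / 2 else 0
  obtain ⟨s, hs, m, hm⟩ := exists_gt_abs_mul_sub_sub_intCast_lt hind (fun j => c j / π)
    (div_pos hε0 Real.pi_pos) ((R + ε * C) / π)
  set t : ℝ := s * π with ht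
  have htR : R + ε * C < t := (div_lt_iff₀ Real.pi_pos).1 hs
  have htm : ∀ j, |t * L j - c j - m j * π| < ε := fun j => by
    have h := hm j
    have heq : t * L j - c j - m j * π = (s * L j - c j / π - m j) * π := by
      have := Real.pi_ne_zero
      rw [ht]
      field_simp
    rwa [lt_div_iff₀ Real.pi_pos, ← abs_of_pos Real.pi_pos, ← abs_mul, abs_of_pos Real.pi_pos,
      ← heq] at h
  have hc1 : c i₁ = π / 2 := by simp [c]
  have hc2 : c i₂ = π / 2 := by simp [c]
  have hpole : ∀ i, (L i)⁻¹ ≤ C →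
      (c i + m i * π) / L i ∈ Set.Icc (t - ε * C) (t + ε * C) := fun i hi => by
    have hLi := hL i
    have h : |(c i + m i * π) / L i - t| ≤ ε * C := by
      have : (c i + m i * π) / L i - t = -((t * L i - c i - m i * π) * (L i)⁻¹) := by
        field_simp
        ring
      rw [this, abs_neg, abs_mul, abs_of_pos (inv_pos.2 hLi)]
      exact mul_le_mul (htm i).le hi (inv_pos.2 hLi).le hε0.le
    obtain ⟨h3, h4⟩ := abs_le.1 h
    exact ⟨by linarith, by linarith⟩
  set p : ℝ := (c i₁ + m i₁ * π) / L i₁ with hp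
  set q : ℝ := (c i₂ + m i₂ * π) / L i₂ with hq
  have hpL : p * L i₁ = π / 2 + m i₁ * π := by
    rw [hp, div_mul_cancel₀ _ (hL i₁).ne', hc1]
  have hqL : q * L i₂ = π / 2 + m i₂ * π := by
    rw [hq, div_mul_cancel₀ _ (hL i₂).ne', hc2]
  have hpq : p ≠ q := by
    intro h
    refine odd_mul_ne_odd_mul hind hne (m i₁) (m i₂) (mul_left_cancel₀ Real.pi_ne_zero ?_)
    rw [← h] at hqL
    linear_combination 2 * L i₁ * hqL - 2 * L i₂ * hpL
  have hIcc : ∀ x ∈ Set.uIcc p q, x ∈ Set.Icc (t - ε * C) (t + ε * C) := fun x hx =>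
    Set.uIcc_subset_Icc (hpole i₁ (by linarith)) (hpole i₂ (by linarith)) hx
  have hnear : ∀ x ∈ Set.uIcc p q, ∀ j, |x * L j - c j - m j * π| < η := fun x hx j => by
    have h3 : |x - t| ≤ ε * C := by
      obtain ⟨h4, h5⟩ := hIcc x hx
      exact abs_le.2 ⟨by linarith, by linarith⟩
    have h4 : |(x - t) * L j| ≤ ε * C * ∑ j, L j := by
      rw [abs_mul, abs_of_pos (hL j)]
      exact mul_le_mul h3 (hLsum j) (hL j).le (by positivity)
    calc |x * L j - c j - m j * π| = |(t * L j - c j - m j * π) + (x - t) * L j| := by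
          congr 1; ring
      _ ≤ |t * L j - c j - m j * π| + |(x - t) * L j| := abs_add_le _ _
      _ < η := by linarith [htm j]
  have hnear1 : ∀ x ∈ Set.uIcc p q, |(x - p) * L i₁| < η := fun x hx => by
    have h := hnear x hx i₁
    rwa [hc1, sub_sub, ← hpL, ← sub_mul] at h
  have hnear2 : ∀ x ∈ Set.uIcc p q, |(x - q) * L i₂| < η := fun x hx => by
    have h := hnear x hx i₂
    rwa [hc2, sub_sub, ← hqL, ← sub_mul] at h
  have hother : ∀ x ∈ Set.uIcc p q, ∀ j, j ≠ i₁ → j ≠ i₂ →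
      Real.cos (x * L j) ≠ 0 ∧ |Real.tan (x * L j)| ≤ 2 := fun x hx j hj1 hj2 => by
    have h := hnear x hx j
    simp only [c, hj1, hj2, or_self, if_false, sub_zero] at h
    have := abs_tan_add_int_mul_pi_le_two (h.le.trans hη1) (m j)
    rwa [sub_add_cancel] at this
  obtain ⟨x, hx, hxp, hxq, hx0⟩ := exists_tan_add_tan_add_eq_zero (hL i₁) (hL i₂) (m i₁) (m i₂)
    hpL hqL hpq
    (fun x hx => ⟨(hnear1 x hx).le.trans hη1, (hnear2 x hx).le.trans hη1⟩)
    (S := fun x => ∑ j ∈ (Finset.univ.erase i₁).erase i₂, Real.tan (x * L j)) (by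
      refine continuousOn_finsetSum _ fun j hj x hx => ?_
      simp only [Finset.mem_erase, Finset.mem_univ, and_true] at hj
      exact ((Real.continuousAt_tan.2 (hother x hx j hj.2 hj.1).1).comp
        (f := fun x => x * L j) (by fun_prop)).continuousWithinAt)
  have hd1 : (x - p) * L i₁ ≠ 0 := mul_ne_zero (sub_ne_zero.2 hxp) (hL i₁).ne'
  have hd2 : (x - q) * L i₂ ≠ 0 := mul_ne_zero (sub_ne_zero.2 hxq) (hL i₂).ne'
  have ht1 := lt_abs_tan_near_pole hd1 (hnear1 x hx) hη1 hR hηR (m i₁)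
  have ht2 := lt_abs_tan_near_pole hd2 (hnear2 x hx) hη1 hR hηR (m i₂)
  rw [add_assoc, ← hpL, ← add_mul, sub_add_cancel] at ht1
  rw [add_assoc, ← hqL, ← add_mul, sub_add_cancel] at ht2
  have hcos : ∀ y, R < |Real.tan y| → Real.cos y ≠ 0 := fun y hy h => by
    rw [Real.tan_eq_sin_div_cos, h, div_zero, abs_zero] at hy
    exact hR.not_gt hy
  refine ⟨x, ?_, fun j => ?_, ?_, ht1, fun j hj1 hj2 => (hother x hx j hj1 hj2).2⟩
  · linarith [(hIcc x hx).1]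
  · by_cases hj1 : j = i₁
    · exact hj1 ▸ hcos _ ht1
    by_cases hj2 : j = i₂
    · exact hj2 ▸ hcos _ ht2
    exact (hother x hx j hj1 hj2).1
  · rw [← Finset.add_sum_erase _ _ (Finset.mem_univ i₁),
      ← Finset.add_sum_erase _ _ (Finset.mem_erase.2 ⟨hne.symm, Finset.mem_univ i₂⟩), ← add_assoc]
    exact hx0

end TanRoots

section Limits

open MeasureTheory

theorem tendsto_integral_cos_mul {f : ℝ → ℝ} {l : ℝ} (hl : 0 ≤ l)
    (hf : IntervalIntegrable f volume 0 l) {κ : ℕ → ℝ} (hκ : Tendsto κ atTop atTop) :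
    Tendsto (fun r => ∫ x in (0 : ℝ)..l, Real.cos (2 * κ r * (x - l)) * f x) atTop (𝓝 0) := by
  let g : ℝ → ℂ := (Set.Ioc 0 l).indicator fun x => (f x : ℂ)
  have hw : Tendsto (fun r => κ r / π) atTop (cocompact ℝ) :=
    (hκ.atTop_div_const Real.pi_pos).mono_right atTop_le_cocompact
  have hRL := (Real.tendsto_integral_exp_smul_cocompact g).comp hw
  refine squeeze_zero_norm (fun r => ?_) (tendsto_zero_iff_norm_tendsto_zero.1 hRL)
  have hint : ∫ v : ℝ, Real.fourierChar (-(v * (κ r / π))) • g v =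
      ∫ x in (0 : ℝ)..l, Complex.exp (((-(2 * κ r * x) : ℝ) : ℂ) * Complex.I) * f x := by
    rw [intervalIntegral.integral_of_le hl, ← integral_indicator measurableSet_Ioc]
    refine integral_congr_ae (Eventually.of_forall fun x => ?_)
    by_cases hx : x ∈ Set.Ioc 0 l
    · simp only [g, Set.indicator_of_mem hx, Circle.smul_def, Real.fourierChar_apply, smul_eq_mul]
      congr 4
      have := Real.pi_ne_zero
      field_simp
    · simp [g, Set.indicator_of_notMem hx]
  have hre : ∫ x in (0 : ℝ)..l, Real.cos (2 * κ r * (x - l)) * f x =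
      (Complex.exp (((2 * κ r * l : ℝ) : ℂ) * Complex.I) *
        ∫ x in (0 : ℝ)..l, Complex.exp (((-(2 * κ r * x) : ℝ) : ℂ) * Complex.I) * f x).re := by
    rw [← intervalIntegral.integral_const_mul, ← Complex.reCLM_apply,
      ← ContinuousLinearMap.intervalIntegral_comp_comm]
    · refine intervalIntegral.integral_congr fun x _ => ?_
      simp only [Complex.reCLM_apply]
      rw [← mul_assoc, ← Complex.exp_add, ← add_mul, ← Complex.ofReal_add, Complex.re_mul_ofReal,
        Complex.exp_ofReal_mul_I_re, ← Real.cos_neg]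
      congr 2
      ring
    · have hf' : IntervalIntegrable (fun x => (f x : ℂ)) volume 0 l :=
        ⟨hf.1.ofReal, hf.2.ofReal⟩
      exact (hf'.continuousOn_mul (Continuous.continuousOn (by fun_prop))).const_mul _
  rw [hre, Function.comp_apply, hint]
  refine (Complex.abs_re_le_norm _).trans ?_
  rw [norm_mul, Complex.norm_exp_ofReal_mul_I, one_mul]

theorem tendsto_integral_cos_sq_mul {f : ℝ → ℝ} {l : ℝ} (hl : 0 ≤ l)
    (hf : IntervalIntegrable f volume 0 l) {κ : ℕ → ℝ} (hκ : Tendsto κ atTop atTop) :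
    Tendsto (fun r => ∫ x in (0 : ℝ)..l, Real.cos (κ r * (x - l)) ^ 2 * f x) atTop
      (𝓝 ((∫ x in (0 : ℝ)..l, f x) / 2)) := by
  have h := ((tendsto_integral_cos_mul hl hf hκ).const_add (∫ x in (0 : ℝ)..l, f x)).div_const 2
  rw [add_zero] at h
  refine h.congr fun r => ?_
  rw [← intervalIntegral.integral_add hf
    (hf.continuousOn_mul (Continuous.continuousOn (by fun_prop))),
    ← intervalIntegral.integral_div]
  refine intervalIntegral.integral_congr fun x _ => ?_
  simp only [Real.cos_sq]
  ring_nf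

theorem sec2_eq_one_add_tan_sq {x : ℝ} (hx : Real.cos x ≠ 0) :
    sec2 x = 1 + Real.tan x ^ 2 := by
  rw [sec2, Real.tan_eq_sin_div_cos]
  field_simp
  linarith [Real.sin_sq_add_cos_sq x]

/-- If two of the summands of `∑ j, τ j = 0` blow up and all others stay bounded, the
weights `1 + τ j ^ 2` concentrate evenly on these two. -/
theorem tendsto_one_add_sq_div_sum {ι : Type*} [Fintype ι] [DecidableEq ι] {L : ι → ℝ}
    (hL : ∀ i, 0 < L i) {i₁ i₂ : ι} (hne : i₁ ≠ i₂) {τ : ℕ → ι → ℝ}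
    (hsum : ∀ r, ∑ j, τ r j = 0) (hτ : Tendsto (fun r => |τ r i₁|) atTop atTop) {B : ℝ}
    (hB : ∀ r j, j ≠ i₁ → j ≠ i₂ → |τ r j| ≤ B) (i : ι) :
    Tendsto (fun r => (1 + τ r i ^ 2) / ∑ j, L j * (1 + τ r j ^ 2)) atTop
      (𝓝 ((if i = i₁ ∨ i = i₂ then 1 else 0) / (L i₁ + L i₂))) := by
  have hu : Tendsto (fun r => (τ r i₁)⁻¹) atTop (𝓝 0) := by
    rw [tendsto_zero_iff_abs_tendsto_zero]
    exact hτ.inv_tendsto_atTop.congr fun r => (abs_inv _).symm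
  have hτ0 : ∀ᶠ r in atTop, τ r i₁ ≠ 0 := by
    filter_upwards [hτ.eventually_gt_atTop 0] with r hr
    exact abs_pos.1 hr
  have hsmall : ∀ j, j ≠ i₁ → j ≠ i₂ → Tendsto (fun r => τ r j / τ r i₁) atTop (𝓝 0) := by
    intro j hj1 hj2
    refine squeeze_zero_norm (fun r => ?_) (by simpa using hu.abs.const_mul B)
    rw [div_eq_mul_inv, norm_mul, ← abs_inv]
    exact mul_le_mul_of_nonneg_right (hB r j hj1 hj2) (abs_nonneg _)
  let c : ι → ℝ := fun j => if j = i₁ then 1 else if j = i₂ then -1 else 0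
  have hratio : ∀ j, Tendsto (fun r => τ r j / τ r i₁) atTop (𝓝 (c j)) := by
    intro j
    by_cases hj1 : j = i₁
    · subst hj1
      simp only [c, if_true]
      refine tendsto_const_nhds.congr' ?_
      filter_upwards [hτ0] with r hr
      exact (div_self hr).symm
    by_cases hj2 : j = i₂
    · subst hj2
      simp only [c, hj1, if_true, if_false]
      have h : Tendsto (fun r => -1 - ∑ k ∈ (Finset.univ.erase i₁).erase j, τ r k / τ r i₁) atTop
          (𝓝 (-1 - ∑ k ∈ (Finset.univ.erase i₁).erase j, 0)) := by
        refine tendsto_const_nhds.sub (tendsto_finsetSum _ fun k hk => ?_)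
        simp only [Finset.mem_erase, Finset.mem_univ, and_true] at hk
        exact hsmall k hk.2 hk.1
      rw [Finset.sum_const_zero, sub_zero] at h
      refine h.congr' ?_
      filter_upwards [hτ0] with r hr
      have hs := hsum r
      rw [← Finset.add_sum_erase _ _ (Finset.mem_univ i₁),
        ← Finset.add_sum_erase _ _ (Finset.mem_erase.2 ⟨hj1, Finset.mem_univ j⟩)] at hs
      rw [← Finset.sum_div]
      field_simp
      linarith
    · simpa [c, hj1, hj2] using hsmall j hj1 hj2
  have hweight : ∀ j, Tendsto (fun r => (1 + τ r j ^ 2) / (1 + τ r i₁ ^ 2)) atTop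
      (𝓝 (if j = i₁ ∨ j = i₂ then 1 else 0)) := by
    intro j
    have h := ((hu.pow 2).add ((hratio j).pow 2)).div ((hu.pow 2).add_const 1) (by norm_num)
    have hc : ((0 : ℝ) ^ 2 + c j ^ 2) / (0 ^ 2 + 1) = if j = i₁ ∨ j = i₂ then 1 else 0 := by
      by_cases hj1 : j = i₁ <;> by_cases hj2 : j = i₂ <;> simp [c, hj1, hj2]
    rw [hc] at h
    refine h.congr' ?_
    filter_upwards [hτ0] with r hr
    have : 1 + τ r i₁ ^ 2 ≠ 0 := by positivity
    simp only [Pi.div_apply]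
    field_simp
  have hden := tendsto_finsetSum Finset.univ fun j _ => (hweight j).const_mul (L j)
  have hden_eq : ∑ j, L j * (if j = i₁ ∨ j = i₂ then (1 : ℝ) else 0) = L i₁ + L i₂ := by
    simp only [mul_ite, mul_one, mul_zero]
    rw [← Finset.sum_filter, Finset.filter_or, Finset.sum_union]
    · simp [Finset.filter_eq']
    · simpa [Finset.filter_eq'] using hne
  rw [hden_eq] at hden
  refine ((hweight i).div hden (add_pos (hL i₁) (hL i₂)).ne').congr fun r => ?_
  have h1 : (1 + τ r i₁ ^ 2) ≠ 0 := by positivity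
  have : ∑ j, L j * ((1 + τ r j ^ 2) / (1 + τ r i₁ ^ 2)) =
      (∑ j, L j * (1 + τ r j ^ 2)) / (1 + τ r i₁ ^ 2) := by
    rw [Finset.sum_div]
    exact Finset.sum_congr rfl fun j _ => (mul_div_assoc _ _ _).symm
  simp only [Pi.div_apply]
  rw [this, div_div_div_cancel_right₀ h1]

end Limits

/-- Scarring on two bonds: for any two distinct bonds `i₁, i₂` of a star graph with
rationally independent bond lengths there is a subsequence `(k_{n_r})` of eigenvalues
along which, for every continuously differentiable vector observable `f`,
`⟨ψ^{(n_r)}|f|ψ^{(n_r)}⟩ → (1/(L_{i₁}+L_{i₂}))(∫_0^{L_{i₁}} f_{i₁} + ∫_0^{L_{i₂}} f_{i₂})`. -/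
theorem star_graph_scarred_states
    (v : ℕ) (hv : 2 ≤ v) (L : Fin v → ℝ) (hL : ∀ i, 0 < L i)
    (hind : LinearIndependent ℚ L) (i₁ i₂ : Fin v) (hne : i₁ ≠ i₂)
    (k : ℕ → ℝ) (hk : IsEigenvalueSeq v L k) :
    ∃ n : ℕ → ℕ, StrictMono n ∧
      ∀ f : Fin v → ℝ → ℝ, (∀ i, ContDiffOn ℝ 1 (f i) (Set.Icc 0 (L i))) →
        Tendsto
          (fun r : ℕ => ∑ i, ∫ x in (0:ℝ)..(L i),
            (Real.sqrt (2 * sec2 (k (n r) * L i) / ∑ j, L j * sec2 (k (n r) * L j)) *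
              Real.cos (k (n r) * (x - L i))) ^ 2 * f i x)
          atTop
          (𝓝 ((L i₁ + L i₂)⁻¹ *
            ((∫ x in (0:ℝ)..(L i₁), f i₁ x) + ∫ x in (0:ℝ)..(L i₂), f i₂ x))) := by
  obtain ⟨hmono, -, hcos, htan, hall⟩ := hk
  have hfreq : ∀ r : ℕ, ∃ᶠ n in atTop, (r : ℝ) < k n ∧ (r : ℝ) < |Real.tan (k n * L i₁)| ∧
      ∀ j, j ≠ i₁ → j ≠ i₂ → |Real.tan (k n * L j)| ≤ 2 := by
    intro r
    rw [frequently_atTop]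
    intro N
    have hR1 : (r : ℝ) ≤ max ((r : ℝ) + 1) (k N) := (le_add_of_nonneg_right zero_le_one).trans
      (le_max_left _ _)
    obtain ⟨x, hx, hxc, hx0, hx1, hxj⟩ := exists_sum_tan_eq_zero hL hind hne
      (lt_max_of_lt_left (b := (r : ℝ) + 1) (c := k N) (by positivity))
    obtain ⟨n, rfl⟩ := hall x ((Nat.cast_nonneg r).trans_lt (hR1.trans_lt hx)) hxc hx0
    exact ⟨n, (hmono.lt_iff_lt.1 ((le_max_right _ _).trans_lt hx)).le, hR1.trans_lt hx,
      hR1.trans_lt hx1, hxj⟩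
  obtain ⟨n, hn, hprop⟩ := extraction_forall_of_frequently hfreq
  refine ⟨n, hn, fun f hf => ?_⟩
  have hκ : Tendsto (fun r => k (n r)) atTop atTop :=
    tendsto_atTop_mono (fun r => (hprop r).1.le) tendsto_natCast_atTop_atTop
  have hτ : Tendsto (fun r => |Real.tan (k (n r) * L i₁)|) atTop atTop :=
    tendsto_atTop_mono (fun r => (hprop r).2.1.le) tendsto_natCast_atTop_atTop
  have hint : ∀ i, IntervalIntegrable (f i) MeasureTheory.volume 0 (L i) := fun i =>
    (hf i).continuousOn.intervalIntegrable_of_Icc (hL i).le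
  have hterm : ∀ i r, ∫ x in (0:ℝ)..(L i),
      (Real.sqrt (2 * sec2 (k (n r) * L i) / ∑ j, L j * sec2 (k (n r) * L j)) *
        Real.cos (k (n r) * (x - L i))) ^ 2 * f i x =
      2 * ((1 + Real.tan (k (n r) * L i) ^ 2) / ∑ j, L j * (1 + Real.tan (k (n r) * L j) ^ 2)) *
        ∫ x in (0:ℝ)..(L i), Real.cos (k (n r) * (x - L i)) ^ 2 * f i x := by
    intro i r
    have hsum : 0 ≤ ∑ j, L j * (1 + Real.tan (k (n r) * L j) ^ 2) :=
      Finset.sum_nonneg fun j _ => mul_nonneg (hL j).le (by positivity)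
    rw [← intervalIntegral.integral_const_mul]
    refine intervalIntegral.integral_congr fun x _ => ?_
    simp only [sec2_eq_one_add_tan_sq (hcos _ _)]
    rw [mul_pow, Real.sq_sqrt (by positivity)]
    ring
  simp only [hterm]
  have hlim := tendsto_finsetSum Finset.univ fun i _ =>
    ((tendsto_one_add_sq_div_sum hL hne (τ := fun r j => Real.tan (k (n r) * L j))
      (fun r => htan (n r)) hτ (fun r => (hprop r).2.2) i).const_mul 2).mul
      (tendsto_integral_cos_sq_mul (hL i).le (hint i) hκ)
  convert hlim using 2
  have hval : ∀ i, 2 * ((if i = i₁ ∨ i = i₂ then (1 : ℝ) else 0) / (L i₁ + L i₂)) *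
      ((∫ x in (0:ℝ)..(L i), f i x) / 2) =
      if i = i₁ ∨ i = i₂ then (L i₁ + L i₂)⁻¹ * ∫ x in (0:ℝ)..(L i), f i x else 0 := by
    intro i
    split_ifs <;> ring
  simp only [hval]
  rw [← Finset.sum_filter, Finset.filter_or, Finset.sum_union]
  · simp [Finset.filter_eq', mul_add]
  · simpa [Finset.filter_eq'] using hne
end

section
/- Fix a real η > 0, an integer α ≥ 1, and β₀ > 0. Then the improper integral ∫_0^∞ P_η(ξ)·exp(−√β·τ_η(ξ)) dξ converges uniformly for β ∈ [0, β₀]; that is, the partial integrals ∫_0^X P_η(ξ)·exp(−√β·τ_η(ξ)) dξ converge as X → ∞, uniformly in β ∈ [0, β₀]. -/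
open scoped Real Topology
open Filter

/-- The error function `erf z = (2/√π) ∫_0^z e^{-t²} dt`, along the straight
segment from `0` to `z`. -/
noncomputable def cerf (z : ℂ) : ℂ :=
  2 / Real.sqrt Real.pi * (z * ∫ t in (0:ℝ)..1, Complex.exp (-(t * z) ^ 2))

/-- `w(z) = e^{-z²} erfc(-iz)`. -/
noncomputable def wfun (z : ℂ) : ℂ :=
  Complex.exp (-z ^ 2) * (1 - cerf (-Complex.I * z))

/-- `P_η(ξ)`. -/
noncomputable def Pfun (a : ℕ) (η ξ : ℝ) : ℂ :=
  (Real.sqrt (Real.pi * η) : ℂ)⁻¹ * Complex.exp (Complex.I * (ξ ^ 2 / (4 * η) - Real.pi / 4))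
  + ((a : ℂ) - 1) / (Real.sqrt Real.pi : ℂ) *
      Complex.exp (Complex.I * (Real.pi / 4 - ξ ^ 2 / 4))

/-- `τ_η(ξ)`. -/
noncomputable def taufun (a : ℕ) (η ξ : ℝ) : ℂ :=
  2 * Real.sqrt η / Real.sqrt Real.pi * Complex.exp (Complex.I * (Real.pi / 4 + ξ ^ 2 / (4 * η)))
  + ξ * cerf (Complex.exp (-(Complex.I * (Real.pi / 4))) * ξ / (2 * Real.sqrt η))
  + 2 * ((a : ℂ) - 1) / Real.sqrt Real.pi *
      Complex.exp (-(Complex.I * (Real.pi / 4 + ξ ^ 2 / 4)))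
  + ξ * ((a : ℂ) - 1) * cerf (Complex.exp (Complex.I * (Real.pi / 4)) * ξ / 2)

/-- A family of functions whose increments are `O(1 / X)` uniformly on `s` converges
uniformly on `s`. -/
theorem exists_tendstoUniformlyOn_of_norm_sub_le {F : ℝ → ℝ → ℂ} {s : Set ℝ} {B : ℝ}
    (hF : ∀ X Y : ℝ, 1 ≤ X → X ≤ Y → ∀ x ∈ s, ‖F Y x - F X x‖ ≤ B / X) :
    ∃ g : ℝ → ℂ, TendstoUniformlyOn F g atTop s := by
  have hB : Tendsto (fun X : ℝ => B / X) atTop (𝓝 0) := tendsto_const_nhds.div_atTop tendsto_id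
  have hC : UniformCauchySeqOn F atTop s := by
    intro u hu
    obtain ⟨ε, hε, hεu⟩ := Metric.mem_uniformity_dist.1 hu
    have h1 : ∀ᶠ X : ℝ in atTop, 1 ≤ X ∧ B / X < ε :=
      (eventually_ge_atTop 1).and (hB.eventually (gt_mem_nhds hε))
    filter_upwards [h1.prod_mk h1] with m hm x hx
    apply hεu
    rcases le_total m.1 m.2 with h | h
    · rw [dist_comm, dist_eq_norm]
      exact (hF _ _ hm.1.1 h x hx).trans_lt hm.1.2
    · rw [dist_eq_norm]
      exact (hF _ _ hm.2.1 h x hx).trans_lt hm.2.2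
  choose! g hg using fun x (hx : x ∈ s) =>
    cauchy_map_iff_exists_tendsto.1 (hC.cauchy_map hx)
  exact ⟨g, hC.tendstoUniformlyOn_of_tendsto hg⟩

/-- If `T` has second derivative `P`, first derivative `b + O(1 / x)` and is itself
`b x + O(1)`, then the integrals of `P exp (-s T)` over `[X, Y]` are `O(1 / X)`, uniformly for `s`
in a bounded interval `[0, S]`. -/
theorem norm_integral_mul_cexp_le {T T' P : ℝ → ℂ} {b C S s X Y : ℝ} (hb : 0 < b)
    (hT : ∀ x, HasDerivAt T (T' x) x) (hT' : ∀ x, HasDerivAt T' (P x) x) (hP : Continuous P)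
    (hT'b : ∀ x, 0 < x → ‖T' x - b‖ ≤ C / x) (hTb : ∀ x, 0 < x → ‖T x - b * x‖ ≤ C)
    (hs : 0 ≤ s) (hsS : s ≤ S) (hX : 1 ≤ X) (hXY : X ≤ Y) :
    ‖∫ ξ in X..Y, P ξ * Complex.exp (-(s : ℂ) * T ξ)‖ ≤
      (Real.exp (S * C) * C * (2 + (b + C) / b)) / X := by
  have hTc : Continuous T := continuous_iff_continuousAt.2 fun x => (hT x).continuousAt
  have hT'c : Continuous T' := continuous_iff_continuousAt.2 fun x => (hT' x).continuousAt
  have hX0 : 0 < X := by linarith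
  have hC : 0 ≤ C := (norm_nonneg _).trans (hTb 1 one_pos)
  set K := Real.exp (S * C) with hK
  have hK0 : 0 < K := Real.exp_pos _
  have hexp : ∀ x, 0 < x → ‖Complex.exp (-(s : ℂ) * T x)‖ ≤ K * Real.exp (-(s * b * x)) := by
    intro x hx
    rw [Complex.norm_exp, hK, ← Real.exp_add, Real.exp_le_exp]
    have h1 : -(T x - b * x).re ≤ C :=
      (neg_le_abs _).trans ((Complex.abs_re_le_norm _).trans (hTb x hx))
    have h2 : (T x - b * x).re = (T x).re - b * x := by simp
    have h3 : (-(s : ℂ) * T x).re = -s * (T x).re := by simp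
    rw [h3]
    rw [h2] at h1
    nlinarith [mul_le_mul_of_nonneg_left h1 hs, mul_le_mul_of_nonneg_right hsS hC]
  have hexp1 : ∀ x, 0 < x → ‖Complex.exp (-(s : ℂ) * T x)‖ ≤ K := by
    intro x hx
    refine (hexp x hx).trans (mul_le_of_le_one_right hK0.le ?_)
    rw [Real.exp_le_one_iff, neg_nonpos]
    positivity
  have hlow : ∀ x, X ≤ x → ‖T' x - b‖ ≤ C / X := fun x hx =>
    (hT'b x (hX0.trans_le hx)).trans (by gcongr)
  have hT'n : ∀ x, X ≤ x → ‖T' x‖ ≤ b + C := by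
    intro x hx
    have h1 : ‖T' x‖ ≤ ‖T' x - b‖ + ‖(b : ℂ)‖ := by
      simpa using norm_add_le (T' x - b) (b : ℂ)
    have h2 : ‖(b : ℂ)‖ = b := by rw [Complex.norm_real, Real.norm_of_nonneg hb.le]
    have h3 : C / X ≤ C := div_le_self hC hX
    linarith [hlow x hx]
  set u : ℝ → ℂ := fun x => (T' x - b) * Complex.exp (-(s : ℂ) * T x) with hu
  set v : ℝ → ℂ := fun x => (T' x - b) * T' x * (s * Complex.exp (-(s : ℂ) * T x)) with hv
  have hderiv : ∀ x, HasDerivAt u (P x * Complex.exp (-(s : ℂ) * T x) - v x) x := by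
    intro x
    have := ((hT' x).sub_const (b : ℂ)).mul ((hT x).const_mul (-(s : ℂ))).cexp
    refine this.congr_deriv ?_
    simp only [hv]
    ring
  have hfc : Continuous fun x => P x * Complex.exp (-(s : ℂ) * T x) := by fun_prop
  have hvc : Continuous v := by fun_prop
  have hparts := intervalIntegral.integral_eq_sub_of_hasDerivAt (a := X) (b := Y)
    (fun x _ => hderiv x) ((hfc.sub hvc).intervalIntegrable _ _)
  rw [intervalIntegral.integral_sub (hfc.intervalIntegrable _ _) (hvc.intervalIntegrable _ _),
    sub_eq_iff_eq_add] at hparts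
  have hubd : ∀ x, X ≤ x → ‖u x‖ ≤ C / X * K := by
    intro x hx
    rw [hu, norm_mul]
    exact mul_le_mul (hlow x hx) (hexp1 x (hX0.trans_le hx)) (norm_nonneg _) (by positivity)
  have hvbd : ‖∫ x in X..Y, v x‖ ≤
      ∫ x in X..Y, C / X * (b + C) * (s * (K * Real.exp (-(s * b * x)))) := by
    refine intervalIntegral.norm_integral_le_of_norm_le hXY ?_
      (Continuous.intervalIntegrable (by fun_prop) _ _)
    refine Eventually.of_forall fun x hx => ?_
    rw [hv, norm_mul, norm_mul, norm_mul, Complex.norm_real, Real.norm_of_nonneg hs]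
    have := hlow x hx.1.le
    have := hT'n x hx.1.le
    have := hexp x (hX0.trans hx.1)
    gcongr
  have hint : ∫ x in X..Y, C / X * (b + C) * (s * (K * Real.exp (-(s * b * x)))) ≤
      C / X * (b + C) * K / b := by
    have hd : ∀ x, HasDerivAt
        (fun x : ℝ => -(C / X * (b + C) * K / b * Real.exp (-(s * b * x))))
        (C / X * (b + C) * (s * (K * Real.exp (-(s * b * x))))) x := by
      intro x
      have := ((((hasDerivAt_id x).const_mul (s * b)).neg.exp).const_mul
        (C / X * (b + C) * K / b)).neg
      refine this.congr_deriv ?_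
      simp only [id, Pi.neg_apply]
      field_simp
    rw [intervalIntegral.integral_eq_sub_of_hasDerivAt (fun x _ => hd x)
      (Continuous.intervalIntegrable (by fun_prop) _ _)]
    have h1 : Real.exp (-(s * b * X)) ≤ 1 := by
      rw [Real.exp_le_one_iff, neg_nonpos]; positivity
    have h2 := Real.exp_pos (-(s * b * Y))
    have h3 : 0 ≤ C / X * (b + C) * K / b := by positivity
    nlinarith
  rw [hparts]
  calc ‖u Y - u X + ∫ x in X..Y, v x‖ ≤ ‖u Y‖ + ‖u X‖ + ‖∫ x in X..Y, v x‖ :=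
        (norm_add_le _ _).trans (by gcongr; exact norm_sub_le _ _)
    _ ≤ C / X * K + C / X * K + C / X * (b + C) * K / b :=
        add_le_add (add_le_add (hubd Y hXY) (hubd X le_rfl)) (hvbd.trans hint)
    _ = K * C * (2 + (b + C) / b) / X := by field_simp; ring

theorem continuous_cerf : Continuous cerf := by
  unfold cerf
  have : Continuous fun z : ℂ => ∫ t in (0:ℝ)..1, Complex.exp (-(t * z) ^ 2) :=
    intervalIntegral.continuous_parametric_intervalIntegral_of_continuous' (by fun_prop) 0 1
  fun_prop

theorem cerf_mul_ofReal (c : ℂ) (x : ℝ) :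
    cerf (c * x) = 2 / Real.sqrt Real.pi * (c * ∫ u in (0:ℝ)..x, Complex.exp (-(u * c) ^ 2)) := by
  have h := intervalIntegral.smul_integral_comp_mul_right (a := 0) (b := 1)
    (fun u : ℝ => Complex.exp (-(u * c) ^ 2)) x
  rw [zero_mul, one_mul, Complex.real_smul] at h
  rw [cerf, ← h, mul_assoc]
  congr 3
  refine intervalIntegral.integral_congr fun t _ => ?_
  simp only [Complex.ofReal_mul]
  ring_nf

theorem hasDerivAt_cerf_mul_ofReal (c : ℂ) (x : ℝ) :
    HasDerivAt (fun x : ℝ => cerf (c * x))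
      (2 / Real.sqrt Real.pi * (c * Complex.exp (-(c * x) ^ 2))) x := by
  simp only [cerf_mul_ofReal]
  have hc : Continuous fun u : ℝ => Complex.exp (-(u * c) ^ 2) := by fun_prop
  have := (intervalIntegral.integral_hasDerivAt_right (hc.intervalIntegrable 0 x)
    (hc.stronglyMeasurableAtFilter _ _) hc.continuousAt)
  rw [mul_comm c (x : ℂ)]
  exact (this.const_mul c).const_mul _

/-- `ξ ↦ e^{-(cξ)²} / (c√π) + ξ erf(cξ)`, the antiderivative of `ξ ↦ erf(cξ)`. -/
noncomputable def cerfPrimitive (c : ℂ) (x : ℝ) : ℂ :=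
  (c * Real.sqrt Real.pi)⁻¹ * Complex.exp (-(c * x) ^ 2) + x * cerf (c * x)

theorem hasDerivAt_cerfPrimitive {c : ℂ} (hc : c ≠ 0) (x : ℝ) :
    HasDerivAt (cerfPrimitive c) (cerf (c * x)) x := by
  have hpi : (Real.sqrt Real.pi : ℂ) ≠ 0 := by
    exact_mod_cast (Real.sqrt_pos.2 Real.pi_pos).ne'
  have hid : HasDerivAt (fun x : ℝ => (x : ℂ)) 1 x := Complex.ofRealCLM.hasDerivAt
  have h1 := (((hid.const_mul c).pow 2).neg.cexp).const_mul (c * Real.sqrt Real.pi : ℂ)⁻¹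
  have h2 := hid.mul (hasDerivAt_cerf_mul_ofReal c x)
  refine (h1.add h2).congr_deriv ?_
  simp only [Pi.pow_apply, Pi.neg_apply]
  field_simp
  ring

/-- One integration by parts bounds the Gaussian integral over `[1, Y]`. -/
theorem norm_integral_cexp_neg_mul_sq_le {b : ℂ} (hb : 0 < b.re) {Y : ℝ} (hY : 1 ≤ Y) :
    ‖∫ t in (1:ℝ)..Y, Complex.exp (-b * t ^ 2)‖ ≤ ‖b‖⁻¹ := by
  have hb0 : b ≠ 0 := by rintro rfl; simp at hb
  have hbn : 0 < ‖b‖ := norm_pos_iff.2 hb0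
  have hpos : ∀ t ∈ Set.uIcc 1 Y, 0 < t := by
    intro t ht
    rw [Set.uIcc_of_le hY] at ht
    linarith [ht.1]
  have hn : ∀ t : ℝ, ‖Complex.exp (-b * t ^ 2)‖ ≤ 1 := by
    intro t
    rw [Complex.norm_exp, Real.exp_le_one_iff]
    have : (-b * (t : ℂ) ^ 2).re = -(b.re * t ^ 2) := by
      rw [← Complex.ofReal_pow, Complex.re_mul_ofReal, Complex.neg_re, neg_mul]
    rw [this, neg_nonpos]
    positivity
  set u : ℝ → ℂ := fun t => -(2 * b)⁻¹ * ((t : ℂ)⁻¹ * Complex.exp (-b * t ^ 2)) with hu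
  set v : ℝ → ℂ := fun t => -(2 * b)⁻¹ * (((t : ℂ) ^ 2)⁻¹ * Complex.exp (-b * t ^ 2)) with hv
  have hderiv : ∀ t ∈ Set.uIcc 1 Y, HasDerivAt u (Complex.exp (-b * t ^ 2) - v t) t := by
    intro t ht
    have ht0 : (t : ℂ) ≠ 0 := by exact_mod_cast (hpos t ht).ne'
    have hid : HasDerivAt (fun x : ℝ => (x : ℂ)) 1 t := Complex.ofRealCLM.hasDerivAt
    have := ((hid.inv ht0).mul ((hid.pow 2).const_mul (-b)).cexp).const_mul (-(2 * b)⁻¹)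
    refine this.congr_deriv ?_
    simp only [hv, Pi.pow_apply, Pi.inv_apply]
    field_simp
    ring
  have hfc : Continuous fun t : ℝ => Complex.exp (-b * t ^ 2) := by fun_prop
  have hvc : ContinuousOn v (Set.uIcc 1 Y) := by
    refine continuousOn_const.mul (ContinuousOn.mul (ContinuousOn.inv₀ (by fun_prop) ?_)
      hfc.continuousOn)
    intro t ht
    have ht0 : (t : ℂ) ≠ 0 := by exact_mod_cast (hpos t ht).ne'
    exact pow_ne_zero 2 ht0
  have hparts := intervalIntegral.integral_eq_sub_of_hasDerivAt hderiv
    ((hfc.intervalIntegrable _ _).sub hvc.intervalIntegrable)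
  rw [intervalIntegral.integral_sub (hfc.intervalIntegrable _ _) hvc.intervalIntegrable,
    sub_eq_iff_eq_add] at hparts
  have hubd : ∀ t : ℝ, 0 < t → ‖u t‖ ≤ (2 * ‖b‖)⁻¹ * t⁻¹ := by
    intro t ht
    rw [hu, norm_mul, norm_mul, norm_neg, norm_inv, norm_inv, norm_mul, Complex.norm_two,
      Complex.norm_real, Real.norm_of_nonneg ht.le]
    have := mul_le_of_le_one_right (inv_nonneg.2 ht.le) (hn t)
    gcongr
  have hd : ∀ t ∈ Set.uIcc 1 Y,
      HasDerivAt (fun t : ℝ => -((2 * ‖b‖)⁻¹ * t⁻¹)) ((2 * ‖b‖)⁻¹ * (t ^ 2)⁻¹) t := by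
    intro t ht
    refine (((hasDerivAt_inv (hpos t ht).ne').const_mul (2 * ‖b‖)⁻¹).neg).congr_deriv ?_
    ring
  have hgi : IntervalIntegrable (fun t : ℝ => (2 * ‖b‖)⁻¹ * (t ^ 2)⁻¹)
      MeasureTheory.volume 1 Y := by
    refine ContinuousOn.intervalIntegrable (continuousOn_const.mul
      (ContinuousOn.inv₀ (by fun_prop) fun t ht => pow_ne_zero 2 (hpos t ht).ne'))
  have hvbd : ‖∫ t in (1:ℝ)..Y, v t‖ ≤ ∫ t in (1:ℝ)..Y, (2 * ‖b‖)⁻¹ * (t ^ 2)⁻¹ := by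
    refine intervalIntegral.norm_integral_le_of_norm_le hY ?_ hgi
    refine Eventually.of_forall fun t ht => ?_
    rw [hv, norm_mul, norm_mul, norm_neg, norm_inv, norm_inv, norm_mul, Complex.norm_two,
      norm_pow, Complex.norm_real, Real.norm_of_nonneg (by linarith [ht.1])]
    have := mul_le_of_le_one_right (inv_nonneg.2 (sq_nonneg t)) (hn t)
    gcongr
  rw [intervalIntegral.integral_eq_sub_of_hasDerivAt hd hgi] at hvbd
  rw [hparts]
  calc ‖u Y - u 1 + ∫ t in (1:ℝ)..Y, v t‖ ≤ ‖u Y‖ + ‖u 1‖ + ‖∫ t in (1:ℝ)..Y, v t‖ :=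
        (norm_add_le _ _).trans (by gcongr; exact norm_sub_le _ _)
    _ ≤ (2 * ‖b‖)⁻¹ * Y⁻¹ + (2 * ‖b‖)⁻¹ * 1⁻¹ +
          (-((2 * ‖b‖)⁻¹ * Y⁻¹) - -((2 * ‖b‖)⁻¹ * 1⁻¹)) :=
        add_le_add (add_le_add (hubd Y (by linarith)) (hubd 1 one_pos)) hvbd
    _ = ‖b‖⁻¹ := by field_simp; ring

theorem norm_cerf_sub_one_le_of_re_sq_pos {z : ℂ} (hz : 0 < z.re) (hz2 : 0 < (z ^ 2).re) :
    ‖cerf z - 1‖ ≤ 2 / Real.sqrt Real.pi * ‖z‖⁻¹ := by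
  have hz0 : z ≠ 0 := by rintro rfl; simp at hz
  have hsp := Real.sqrt_pos.2 Real.pi_pos
  have hpi : (Real.sqrt Real.pi : ℂ) ≠ 0 := by exact_mod_cast hsp.ne'
  have hroot : ((Real.pi : ℂ) / z ^ 2) ^ (1 / 2 : ℂ) = Real.sqrt Real.pi / z := by
    have h1 : (Real.pi : ℂ) / z ^ 2 = (Real.sqrt Real.pi / z) ^ 2 := by
      rw [div_pow, ← Complex.ofReal_pow, Real.sq_sqrt Real.pi_pos.le]
    have h2 : 0 < ((Real.sqrt Real.pi : ℂ) / z).re := by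
      rw [div_eq_mul_inv, Complex.re_ofReal_mul, Complex.inv_re]
      have := Complex.normSq_pos.2 hz0
      positivity
    rw [h1, one_div, Complex.sq_cpow_two_inv h2]
  have hgauss := integral_gaussian_complex_Ioi hz2
  rw [hroot] at hgauss
  have hlim : Tendsto (fun Y : ℝ => ∫ t in (0:ℝ)..Y, Complex.exp (-z ^ 2 * t ^ 2)) atTop
      (𝓝 (Real.sqrt Real.pi / z / 2)) := by
    rw [← hgauss]
    exact MeasureTheory.intervalIntegral_tendsto_integral_Ioi 0
      (integrable_cexp_neg_mul_sq hz2).integrableOn tendsto_id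
  have hcerf : cerf z = 2 / Real.sqrt Real.pi *
      (z * ∫ t in (0:ℝ)..1, Complex.exp (-z ^ 2 * t ^ 2)) := by
    rw [cerf]
    congr 3
    funext t
    ring_nf
  have hfc : Continuous fun t : ℝ => Complex.exp (-z ^ 2 * t ^ 2) := by fun_prop
  have hbd : ‖(Real.sqrt Real.pi / z / 2) - ∫ t in (0:ℝ)..1, Complex.exp (-z ^ 2 * t ^ 2)‖ ≤
      ‖z ^ 2‖⁻¹ := by
    refine le_of_tendsto (hlim.sub_const _).norm ?_
    filter_upwards [eventually_ge_atTop 1] with Y hY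
    rw [intervalIntegral.integral_interval_sub_left (hfc.intervalIntegrable _ _)
      (hfc.intervalIntegrable _ _)]
    exact norm_integral_cexp_neg_mul_sq_le hz2 hY
  have hfact : cerf z - 1 = -(2 / Real.sqrt Real.pi * z *
      ((Real.sqrt Real.pi / z / 2) - ∫ t in (0:ℝ)..1, Complex.exp (-z ^ 2 * t ^ 2))) := by
    rw [hcerf]
    field_simp
    ring
  rw [hfact, norm_neg, norm_mul, norm_mul, norm_div, Complex.norm_two, Complex.norm_real,
    Real.norm_of_nonneg hsp.le]
  have hzn : 0 < ‖z‖ := norm_pos_iff.2 hz0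
  calc _ ≤ 2 / Real.sqrt Real.pi * ‖z‖ * ‖z ^ 2‖⁻¹ := by gcongr
    _ = _ := by rw [norm_pow]; field_simp

/-- `erf z = 1 + O(1 / |z|)` on the closed sector `|arg z| ≤ π / 4`. -/
theorem norm_cerf_sub_one_le {z : ℂ} (hz : 0 < z.re) (hz2 : 0 ≤ (z ^ 2).re) :
    ‖cerf z - 1‖ ≤ 2 / Real.sqrt Real.pi * ‖z‖⁻¹ := by
  have hz0 : z ≠ 0 := by rintro rfl; simp at hz
  have hc : Tendsto (fun ε : ℝ => z + ε) (𝓝[>] 0) (𝓝 z) := by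
    have : Continuous fun ε : ℝ => z + ε := by fun_prop
    simpa using (this.tendsto 0).mono_left nhdsWithin_le_nhds
  refine le_of_tendsto_of_tendsto (((continuous_cerf.tendsto z).comp hc).sub_const 1).norm
    ((hc.norm.inv₀ (norm_ne_zero_iff.2 hz0)).const_mul _) ?_
  filter_upwards [self_mem_nhdsWithin] with ε hε
  have hε : 0 < ε := hε
  apply norm_cerf_sub_one_le_of_re_sq_pos
  · simp only [Complex.add_re, Complex.ofReal_re]
    positivity
  · simp only [sq, Complex.mul_re, Complex.add_re, Complex.add_im, Complex.ofReal_re,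
      Complex.ofReal_im] at hz2 ⊢
    nlinarith [mul_pos hz hε, mul_pos hε hε]

theorem norm_cerf_mul_sub_one_le {c : ℂ} (hc : 0 < c.re) (hc2 : 0 ≤ (c ^ 2).re) {x : ℝ}
    (hx : 0 < x) : ‖cerf (c * x) - 1‖ ≤ 2 * ‖c‖⁻¹ / x := by
  have hs : 1 ≤ Real.sqrt Real.pi := Real.one_le_sqrt.2 (by linarith [Real.pi_gt_three])
  have h := norm_cerf_sub_one_le (z := c * x) (by rw [Complex.re_mul_ofReal]; positivity)
    (by rw [mul_pow, ← Complex.ofReal_pow, Complex.re_mul_ofReal]; positivity)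
  refine h.trans ?_
  rw [norm_mul, Complex.norm_real, Real.norm_of_nonneg hx.le, mul_inv, ← mul_assoc,
    ← div_eq_mul_inv _ x]
  gcongr
  exact div_le_self zero_le_two hs

theorem norm_cerfPrimitive_sub_le {c : ℂ} (hc : 0 < c.re) (hc2 : 0 ≤ (c ^ 2).re) {x : ℝ}
    (hx : 0 < x) : ‖cerfPrimitive c x - x‖ ≤ 3 * ‖c‖⁻¹ := by
  have hs : 1 ≤ Real.sqrt Real.pi := Real.one_le_sqrt.2 (by linarith [Real.pi_gt_three])
  have hc0 : c ≠ 0 := by rintro rfl; simp at hc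
  have hcn : 0 < ‖c‖ := norm_pos_iff.2 hc0
  have hexp : ‖Complex.exp (-(c * x) ^ 2)‖ ≤ 1 := by
    rw [Complex.norm_exp, Real.exp_le_one_iff, Complex.neg_re, mul_pow, ← Complex.ofReal_pow,
      Complex.re_mul_ofReal, neg_nonpos]
    positivity
  have h1 : ‖(c * Real.sqrt Real.pi)⁻¹ * Complex.exp (-(c * x) ^ 2)‖ ≤ ‖c‖⁻¹ := by
    rw [norm_mul, norm_inv, norm_mul, Complex.norm_real, Real.norm_of_nonneg (by positivity),
      mul_inv]
    refine (mul_le_of_le_one_right (by positivity) hexp).trans ?_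
    exact mul_le_of_le_one_right (by positivity) (inv_le_one_of_one_le₀ hs)
  have h2 : ‖(x : ℂ) * (cerf (c * x) - 1)‖ ≤ 2 * ‖c‖⁻¹ := by
    rw [norm_mul, Complex.norm_real, Real.norm_of_nonneg hx.le]
    calc _ ≤ x * (2 * ‖c‖⁻¹ / x) := by gcongr; exact norm_cerf_mul_sub_one_le hc hc2 hx
      _ = _ := by field_simp
  have h3 : cerfPrimitive c x - x =
      (c * Real.sqrt Real.pi)⁻¹ * Complex.exp (-(c * x) ^ 2) + x * (cerf (c * x) - 1) := by
    rw [cerfPrimitive]; ring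
  rw [h3]
  linarith [norm_add_le ((c * Real.sqrt Real.pi)⁻¹ * Complex.exp (-(c * x) ^ 2))
    ((x : ℂ) * (cerf (c * x) - 1))]

theorem exp_I_mul_pi_div_four_sq : Complex.exp (Complex.I * (Real.pi / 4)) ^ 2 = Complex.I := by
  have h : ((2 : ℕ) : ℂ) * (Complex.I * (Real.pi / 4)) = Real.pi / 2 * Complex.I := by
    push_cast
    ring
  rw [← Complex.exp_nat_mul, h, Complex.exp_pi_div_two_mul_I]

theorem exp_neg_I_mul_pi_div_four_sq :
    Complex.exp (-(Complex.I * (Real.pi / 4))) ^ 2 = -Complex.I := by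
  rw [Complex.exp_neg, inv_pow, exp_I_mul_pi_div_four_sq, Complex.inv_I]

/-- The improper integral `∫_0^∞ P_η(ξ) exp(−√β τ_η(ξ)) dξ` converges uniformly for
`β ∈ [0, β₀]`: the partial integrals over `[0, X]` converge as `X → ∞`, uniformly in
`β ∈ [0, β₀]`. -/
theorem P_exp_integral_uniformly_convergent
    (a : ℕ) (ha : 1 ≤ a) (η : ℝ) (hη : 0 < η) (β₀ : ℝ) (hβ₀ : 0 < β₀) :
    ∃ g : ℝ → ℂ, TendstoUniformlyOn
      (fun (X : ℝ) (β : ℝ) => ∫ ξ in (0:ℝ)..X,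
        Pfun a η ξ * Complex.exp (-(Real.sqrt β : ℂ) * taufun a η ξ))
      g atTop (Set.Icc 0 β₀) := by
  have hsη : 0 < Real.sqrt η := Real.sqrt_pos.2 hη
  have hη2 : (Real.sqrt η : ℂ) ^ 2 = η := by
    rw [← Complex.ofReal_pow, Real.sq_sqrt hη.le]
  set c₁ : ℂ := Complex.exp (-(Complex.I * (Real.pi / 4))) / (2 * Real.sqrt η) with hc₁
  set c₂ : ℂ := Complex.exp (Complex.I * (Real.pi / 4)) / 2 with hc₂
  have hsq₁ : c₁ ^ 2 = -(Complex.I / (4 * η)) := by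
    rw [hc₁, div_pow, exp_neg_I_mul_pi_div_four_sq, mul_pow, hη2, neg_div]
    norm_num
  have hsq₂ : c₂ ^ 2 = Complex.I / 4 := by
    rw [hc₂, div_pow, exp_I_mul_pi_div_four_sq]
    norm_num
  have hre₁ : 0 < c₁.re := by
    have h : c₁ =
        Complex.exp ((-(Real.pi / 4) : ℝ) * Complex.I) / ((2 * Real.sqrt η : ℝ) : ℂ) := by
      rw [hc₁]; push_cast; ring_nf
    rw [h, Complex.div_ofReal_re, Complex.exp_ofReal_mul_I_re, Real.cos_neg, Real.cos_pi_div_four]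
    positivity
  have hre₂ : 0 < c₂.re := by
    have h : c₂ = Complex.exp ((Real.pi / 4 : ℝ) * Complex.I) / ((2 : ℝ) : ℂ) := by
      rw [hc₂]; push_cast; ring_nf
    rw [h, Complex.div_ofReal_re, Complex.exp_ofReal_mul_I_re, Real.cos_pi_div_four]
    positivity
  have hre_sq₁ : 0 ≤ (c₁ ^ 2).re := by
    have h : -(Complex.I / (4 * η)) = -(Complex.I / ((4 * η : ℝ) : ℂ)) := by push_cast; rfl
    rw [hsq₁, h, Complex.neg_re, Complex.div_ofReal_re]
    simp
  have hre_sq₂ : 0 ≤ (c₂ ^ 2).re := by rw [hsq₂]; simp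
  have hne₁ : c₁ ≠ 0 := by intro h; simp [h] at hre₁
  have hne₂ : c₂ ≠ 0 := by intro h; simp [h] at hre₂
  have hexp₁ : ∀ x : ℝ,
      Complex.exp (-(c₁ * x) ^ 2) = Complex.exp (Complex.I * (x ^ 2 / (4 * η))) := by
    intro x
    rw [mul_pow, hsq₁]
    ring_nf
  have hexp₂ : ∀ x : ℝ, Complex.exp (-(c₂ * x) ^ 2) = Complex.exp (-(Complex.I * (x ^ 2 / 4))) := by
    intro x
    rw [mul_pow, hsq₂]
    ring_nf
  have hη0 : (Real.sqrt η : ℂ) ≠ 0 := by exact_mod_cast hsη.ne'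
  have hpi0 : (Real.sqrt Real.pi : ℂ) ≠ 0 := by
    exact_mod_cast (Real.sqrt_pos.2 Real.pi_pos).ne'
  have he0 := Complex.exp_ne_zero (Complex.I * (Real.pi / 4))
  have htau : taufun a η = fun x => cerfPrimitive c₁ x + ((a : ℂ) - 1) * cerfPrimitive c₂ x := by
    funext x
    have h₁ : Complex.exp (-(Complex.I * (Real.pi / 4))) * x / (2 * Real.sqrt η) = c₁ * x := by
      rw [hc₁]; ring
    have h₂ : Complex.exp (Complex.I * (Real.pi / 4)) * x / 2 = c₂ * x := by rw [hc₂]; ring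
    rw [taufun, h₁, h₂, cerfPrimitive, cerfPrimitive, hexp₁, hexp₂, mul_add, mul_add, neg_add,
      Complex.exp_add, Complex.exp_add, mul_inv, mul_inv]
    have h₃ : c₁⁻¹ = 2 * Real.sqrt η * Complex.exp (Complex.I * (Real.pi / 4)) := by
      rw [hc₁, Complex.exp_neg]; field_simp
    have h₄ : c₂⁻¹ = 2 * Complex.exp (-(Complex.I * (Real.pi / 4))) := by
      rw [hc₂, Complex.exp_neg]; field_simp
    rw [h₃, h₄]
    ring
  have hP : Pfun a η = fun x : ℝ => 2 / Real.sqrt Real.pi * (c₁ * Complex.exp (-(c₁ * x) ^ 2)) +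
      ((a : ℂ) - 1) * (2 / Real.sqrt Real.pi * (c₂ * Complex.exp (-(c₂ * x) ^ 2))) := by
    funext x
    rw [hexp₁, hexp₂, Pfun, Real.sqrt_mul Real.pi_pos.le, Complex.ofReal_mul, mul_sub, mul_sub,
      sub_eq_add_neg (Complex.I * _), sub_eq_add_neg (Complex.I * _), Complex.exp_add,
      Complex.exp_add, hc₁, hc₂]
    field_simp
  have hT : ∀ x : ℝ, HasDerivAt (taufun a η) (cerf (c₁ * x) + ((a : ℂ) - 1) * cerf (c₂ * x)) x := by
    intro x
    rw [htau]
    exact (hasDerivAt_cerfPrimitive hne₁ x).add ((hasDerivAt_cerfPrimitive hne₂ x).const_mul _)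
  have hT' : ∀ x : ℝ, HasDerivAt (fun x : ℝ => cerf (c₁ * x) + ((a : ℂ) - 1) * cerf (c₂ * x))
      (Pfun a η x) x := by
    intro x
    rw [hP]
    exact (hasDerivAt_cerf_mul_ofReal c₁ x).add ((hasDerivAt_cerf_mul_ofReal c₂ x).const_mul _)
  have hPc : Continuous (Pfun a η) := by
    rw [hP]
    fun_prop
  set C : ℝ := 3 * ‖c₁‖⁻¹ + ‖(a : ℂ) - 1‖ * (3 * ‖c₂‖⁻¹) with hC
  have hT'b : ∀ x : ℝ, 0 < x →
      ‖cerf (c₁ * x) + ((a : ℂ) - 1) * cerf (c₂ * x) - (a : ℝ)‖ ≤ C / x := by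
    intro x hx
    have h : cerf (c₁ * x) + ((a : ℂ) - 1) * cerf (c₂ * x) - (a : ℝ) =
        (cerf (c₁ * x) - 1) + ((a : ℂ) - 1) * (cerf (c₂ * x) - 1) := by push_cast; ring
    rw [h]
    calc _ ≤ ‖cerf (c₁ * x) - 1‖ + ‖(a : ℂ) - 1‖ * ‖cerf (c₂ * x) - 1‖ :=
          (norm_add_le _ _).trans (by rw [norm_mul])
      _ ≤ 2 * ‖c₁‖⁻¹ / x + ‖(a : ℂ) - 1‖ * (2 * ‖c₂‖⁻¹ / x) := by
          gcongr
          · exact norm_cerf_mul_sub_one_le hre₁ hre_sq₁ hx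
          · exact norm_cerf_mul_sub_one_le hre₂ hre_sq₂ hx
      _ ≤ 3 * ‖c₁‖⁻¹ / x + ‖(a : ℂ) - 1‖ * (3 * ‖c₂‖⁻¹ / x) := by gcongr <;> norm_num
      _ = C / x := by rw [hC]; ring
  have hTb : ∀ x : ℝ, 0 < x → ‖taufun a η x - (a : ℝ) * x‖ ≤ C := by
    intro x hx
    have h : taufun a η x - (a : ℝ) * x =
        (cerfPrimitive c₁ x - x) + ((a : ℂ) - 1) * (cerfPrimitive c₂ x - x) := by
      rw [htau]; push_cast; ring
    rw [h]
    calc _ ≤ ‖cerfPrimitive c₁ x - x‖ + ‖(a : ℂ) - 1‖ * ‖cerfPrimitive c₂ x - x‖ :=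
          (norm_add_le _ _).trans (by rw [norm_mul])
      _ ≤ C := by
          rw [hC]
          gcongr
          · exact norm_cerfPrimitive_sub_le hre₁ hre_sq₁ hx
          · exact norm_cerfPrimitive_sub_le hre₂ hre_sq₂ hx
  have ha0 : (0 : ℝ) < a := by exact_mod_cast ha
  have hTc : Continuous (taufun a η) := continuous_iff_continuousAt.2 fun x => (hT x).continuousAt
  refine exists_tendstoUniformlyOn_of_norm_sub_le
    (B := Real.exp (Real.sqrt β₀ * C) * C * (2 + (a + C) / a)) fun X Y hX hXY β hβ => ?_
  have hfc : Continuous fun ξ : ℝ =>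
      Pfun a η ξ * Complex.exp (-(Real.sqrt β : ℂ) * taufun a η ξ) := by fun_prop
  rw [intervalIntegral.integral_interval_sub_left (hfc.intervalIntegrable _ _)
    (hfc.intervalIntegrable _ _)]
  exact norm_integral_mul_cexp_le ha0 hT hT' hPc hT'b hTb (Real.sqrt_nonneg β)
    (Real.sqrt_le_sqrt hβ.2) hX hXY
end
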